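/- Let k ≥ 1 and n ≥ k + 1. The number of k-element subsets S of the cyclic group Z_n such that no two distinct elements of S differ by one modulo n (i.e., for all distinct x, y ∈ S, x − y ≢ 1 (mod n)) is equal to (n/(n − k)) · C(n − k, k). -/

import Mathlib

/-- `k`-subsets of `[a, b)` without consecutive elements. -/
def linSets (a b k : ℕ) : Finset (Finset ℕ) :=
  ((Finset.Ico a b).powersetCard k).filter (fun S => ∀ x ∈ S, x + 1 ∉ S)

theorem mem_linSets (a b k : ℕ) (S : Finset ℕ) :
    S ∈ linSets a b k ↔ (∀ x ∈ S, a ≤ x ∧ x < b) ∧ S.card = k ∧ ∀ x ∈ S, x + 1 ∉ S := by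
  simp only [linSets, Finset.mem_filter, Finset.mem_powersetCard, Finset.subset_iff,
    Finset.mem_Ico, and_assoc]

theorem linSets_zero (a b : ℕ) : (linSets a b 0).card = 1 := by
  rw [Finset.card_eq_one]
  refine ⟨∅, ?_⟩
  ext S
  rw [mem_linSets, Finset.mem_singleton, Finset.card_eq_zero]
  constructor
  · exact fun h => h.2.1
  · rintro rfl; simp

theorem linSets_empty (a b k : ℕ) (h : b ≤ a) : (linSets a b (k + 1)).card = 0 := by
  rw [Finset.card_eq_zero, Finset.eq_empty_iff_forall_notMem]
  intro S hS
  rw [mem_linSets] at hS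
  obtain ⟨x, hx⟩ := Finset.card_pos.1 (by omega : 0 < S.card)
  have := hS.1 x hx
  omega

/-- Recurrence, splitting on whether the top element `b` belongs to the set. -/
theorem linSets_rec (a b k : ℕ) (h : a ≤ b) :
    (linSets a (b + 1) (k + 1)).card = (linSets a b (k + 1)).card + (linSets a (b - 1) k).card := by
  have hinj : Set.InjOn (fun S : Finset ℕ => insert b S) (linSets a (b - 1) k) := by
    intro S hS T hT hST
    rw [Finset.mem_coe, mem_linSets] at hS hT
    have h1 : b ∉ S := fun hb => by have := hS.1 b hb; omega
    have h2 : b ∉ T := fun hb => by have := hT.1 b hb; omega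
    have := congrArg (fun U : Finset ℕ => U.erase b) hST
    simpa [h1, h2] using this
  rw [← Finset.card_image_of_injOn hinj, ← Finset.card_union_of_disjoint]
  · congr 1
    ext S
    rw [Finset.mem_union, Finset.mem_image]
    simp only [mem_linSets]
    constructor
    · rintro ⟨h1, h2, h3⟩
      by_cases hb : b ∈ S
      · right
        refine ⟨S.erase b, ⟨?_, ?_, ?_⟩, Finset.insert_erase hb⟩
        · intro x hx
          rw [Finset.mem_erase] at hx
          have := h1 x hx.2
          have h4 : x + 1 ≠ b := fun h5 => h3 x hx.2 (h5 ▸ hb)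
          have := hx.1
          omega
        · rw [Finset.card_erase_of_mem hb]; omega
        · intro x hx hx'
          exact h3 x (Finset.mem_of_mem_erase hx) (Finset.mem_of_mem_erase hx')
      · left
        refine ⟨fun x hx => ?_, h2, h3⟩
        have := h1 x hx
        have : x ≠ b := fun h5 => hb (h5 ▸ hx)
        omega
    · rintro (⟨h1, h2, h3⟩ | ⟨T, ⟨h1, h2, h3⟩, rfl⟩)
      · exact ⟨fun x hx => by have := h1 x hx; omega, h2, h3⟩
      · have hb : b ∉ T := fun hb => by have := h1 b hb; omega
        refine ⟨?_, ?_, ?_⟩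
        · intro x hx
          rcases Finset.mem_insert.1 hx with rfl | hx
          · omega
          · have := h1 x hx; omega
        · rw [Finset.card_insert_of_notMem hb, h2]
        · intro x hx hx'
          rcases Finset.mem_insert.1 hx with rfl | hx <;>
            rcases Finset.mem_insert.1 hx' with h5 | hx'
          · omega
          · have := h1 _ hx'; omega
          · have := h1 _ hx; omega
          · exact h3 x hx hx'
  · rw [Finset.disjoint_left]
    intro S hS hS'
    obtain ⟨T, -, rfl⟩ := Finset.mem_image.1 hS'
    rw [mem_linSets] at hS
    have := hS.1 b (Finset.mem_insert_self _ _)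
    omega

theorem card_linSets (a m : ℕ) : ∀ k, (linSets a (a + m) k).card = (m + 1 - k).choose k := by
  induction m using Nat.strong_induction_on with
  | _ m ih =>
    intro k
    rcases k with _ | k
    · simp [linSets_zero]
    rcases m with _ | m
    · rw [linSets_empty _ _ _ (by omega)]
      simp
    · rw [← add_assoc, linSets_rec _ _ _ (by omega), ih m (by omega)]
      have h2 : (linSets a (a + m - 1) k).card = (m - k).choose k + if k = m + 1 then 0 else 0 := by
        rcases m with _ | m
        · rcases k with _ | k
          · simp [linSets_zero]
          · rw [linSets_empty _ _ _ (by omega)]; simp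
        · have := ih m (by omega) k
          rw [show a + (m + 1) - 1 = a + m by omega, this]
          simp
      rw [h2]
      simp only [ite_self, add_zero]
      rcases le_or_gt k m with h | h
      · obtain ⟨j, rfl⟩ := Nat.exists_eq_add_of_le h
        rw [show k + j + 1 + 1 - (k + 1) = j + 1 by omega, show k + j + 1 - (k + 1) = j by omega,
          show k + j - k = j by omega, Nat.choose_succ_succ, add_comm]
      · obtain ⟨k, rfl⟩ : ∃ l, k = l + 1 := ⟨k - 1, by omega⟩
        rw [show m + 1 + 1 - (k + 1 + 1) = 0 by omega, show m + 1 - (k + 1 + 1) = 0 by omega,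
          show m - (k + 1) = 0 by omega]
        simp

/-- `k`-subsets of `[0, n)` without cyclically consecutive elements. -/
def cycSets (n k : ℕ) : Finset (Finset ℕ) :=
  (linSets 0 n k).filter (fun S => ¬ (0 ∈ S ∧ n - 1 ∈ S))

theorem card_cycSets (n k : ℕ) (hn : 2 ≤ n) :
    (cycSets n (k + 1)).card =
      (linSets 0 (n - 1) (k + 1)).card + (linSets 1 (n - 2) k).card := by
  obtain ⟨b, rfl⟩ : ∃ b, n = b + 1 := ⟨n - 1, by omega⟩
  have e : b + 1 - 2 = b - 1 := by omega
  rw [e, Nat.add_sub_cancel]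
  have hinj : Set.InjOn (fun S : Finset ℕ => insert b S) (linSets 1 (b - 1) k) := by
    intro S hS T hT hST
    rw [Finset.mem_coe, mem_linSets] at hS hT
    have h1 : b ∉ S := fun hb => by have := hS.1 b hb; omega
    have h2 : b ∉ T := fun hb => by have := hT.1 b hb; omega
    have := congrArg (fun U : Finset ℕ => U.erase b) hST
    simpa [h1, h2] using this
  rw [← Finset.card_image_of_injOn hinj, ← Finset.card_union_of_disjoint]
  · congr 1
    ext S
    rw [Finset.mem_union, Finset.mem_image, cycSets, Finset.mem_filter, Nat.add_sub_cancel]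
    simp only [mem_linSets]
    constructor
    · rintro ⟨⟨h1, h2, h3⟩, h0⟩
      by_cases hb : b ∈ S
      · right
        refine ⟨S.erase b, ⟨?_, ?_, ?_⟩, Finset.insert_erase hb⟩
        · intro x hx
          rw [Finset.mem_erase] at hx
          have := h1 x hx.2
          have h4 : x + 1 ≠ b := fun h5 => h3 x hx.2 (h5 ▸ hb)
          have h6 : x ≠ 0 := fun h5 => h0 ⟨h5 ▸ hx.2, hb⟩
          have := hx.1
          omega
        · rw [Finset.card_erase_of_mem hb]; omega
        · intro x hx hx'
          exact h3 x (Finset.mem_of_mem_erase hx) (Finset.mem_of_mem_erase hx')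
      · left
        refine ⟨fun x hx => ?_, h2, h3⟩
        have := h1 x hx
        have : x ≠ b := fun h5 => hb (h5 ▸ hx)
        omega
    · rintro (⟨h1, h2, h3⟩ | ⟨T, ⟨h1, h2, h3⟩, rfl⟩)
      · exact ⟨⟨fun x hx => by have := h1 x hx; omega, h2, h3⟩,
          fun h => by have := h1 _ h.2; omega⟩
      · have hb : b ∉ T := fun hb => by have := h1 b hb; omega
        refine ⟨⟨?_, ?_, ?_⟩, ?_⟩
        · intro x hx
          rcases Finset.mem_insert.1 hx with rfl | hx
          · omega
          · have := h1 x hx; omega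
        · rw [Finset.card_insert_of_notMem hb, h2]
        · intro x hx hx'
          rcases Finset.mem_insert.1 hx with rfl | hx <;>
            rcases Finset.mem_insert.1 hx' with h5 | hx'
          · omega
          · have := h1 _ hx'; omega
          · have := h1 _ hx; omega
          · exact h3 x hx hx'
        · rintro ⟨h, -⟩
          rcases Finset.mem_insert.1 h with h | h
          · omega
          · have := h1 _ h; omega
  · rw [Finset.disjoint_left]
    intro S hS hS'
    obtain ⟨T, -, rfl⟩ := Finset.mem_image.1 hS'
    rw [mem_linSets] at hS
    have := hS.1 b (Finset.mem_insert_self _ _)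
    omega

theorem ncard_zmod (k n : ℕ) (hn : 2 ≤ n) :
    {S : Finset (ZMod n) | S.card = k ∧
        ∀ x ∈ S, ∀ y ∈ S, x ≠ y → x - y ≠ 1}.ncard = (cycSets n k).card := by
  haveI : NeZero n := ⟨by omega⟩
  haveI : Fact (1 < n) := ⟨by omega⟩
  have vinj : Function.Injective (ZMod.val : ZMod n → ℕ) := ZMod.val_injective n
  rw [← Set.ncard_image_of_injective _ (Finset.image_injective vinj), ← Set.ncard_coe_finset]
  congr 1
  ext T
  rw [Set.mem_image, Finset.mem_coe, cycSets, Finset.mem_filter, mem_linSets]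
  constructor
  · rintro ⟨S, ⟨h1, h2⟩, rfl⟩
    have key : ∀ x ∈ S, ∀ y ∈ S, x ≠ y + 1 := by
      rintro x hx y hy rfl
      exact h2 _ hx _ hy (by simp) (by simp)
    refine ⟨⟨?_, ?_, ?_⟩, ?_⟩
    · intro x hx
      obtain ⟨s, -, rfl⟩ := Finset.mem_image.1 hx
      exact ⟨Nat.zero_le _, ZMod.val_lt s⟩
    · rw [Finset.card_image_of_injective _ vinj, h1]
    · intro x hx hx'
      obtain ⟨s, hs, rfl⟩ := Finset.mem_image.1 hx
      obtain ⟨t, ht, hts⟩ := Finset.mem_image.1 hx'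
      apply key t ht s hs
      have := congrArg (Nat.cast : ℕ → ZMod n) hts
      simpa using this
    · rintro ⟨hx, hx'⟩
      obtain ⟨s, hs, hs0⟩ := Finset.mem_image.1 hx
      obtain ⟨t, ht, hts⟩ := Finset.mem_image.1 hx'
      apply key s hs t ht
      have h3 : t.val + 1 = n := by omega
      have h4 := congrArg (Nat.cast : ℕ → ZMod n) h3
      have h5 := congrArg (Nat.cast : ℕ → ZMod n) hs0
      simp at h4 h5
      rw [h4, h5]
  · rintro ⟨⟨h1, h2, h3⟩, h0⟩
    have hval : ∀ x ∈ T, (x : ZMod n).val = x := fun x hx =>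
      ZMod.val_cast_of_lt (h1 x hx).2
    have himg : (T.image (Nat.cast : ℕ → ZMod n)).image ZMod.val = T := by
      rw [Finset.image_image]
      conv_rhs => rw [← Finset.image_id (s := T)]
      exact Finset.image_congr (fun x hx => hval x hx)
    refine ⟨T.image (Nat.cast : ℕ → ZMod n), ⟨?_, ?_⟩, himg⟩
    · rw [← h2, ← Finset.card_image_of_injective _ vinj, himg]
    · intro x hx y hy _ hxy
      obtain ⟨s, hs, rfl⟩ := Finset.mem_image.1 hx
      obtain ⟨t, ht, rfl⟩ := Finset.mem_image.1 hy
      have e : (s : ZMod n) = ((t + 1 : ℕ) : ZMod n) := by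
        push_cast
        rw [← hxy]; ring
      have e2 := congrArg ZMod.val e
      rw [hval s hs, ZMod.val_natCast] at e2
      have ht' := (h1 t ht).2
      rcases Nat.lt_or_ge (t + 1) n with h | h
      · rw [Nat.mod_eq_of_lt h] at e2
        exact h3 t ht (e2 ▸ hs)
      · have h6 : t + 1 = n := by omega
        rw [h6, Nat.mod_self] at e2
        exact h0 ⟨e2 ▸ hs, by rw [← h6]; simpa using ht⟩


/-- **Kaplansky's theorem.**  Let `k ≥ 1` and `n ≥ k + 1`.  The number of `k`-element
subsets `S` of `ZMod n` such that no two distinct elements of `S` differ by one modulo `n`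
equals the Kaplansky number `(n / (n - k)) * C(n - k, k)`. -/
theorem statement1 (k n : ℕ) (hk : 1 ≤ k) (hn : k + 1 ≤ n) :
    (({S : Finset (ZMod n) | S.card = k ∧
        ∀ x ∈ S, ∀ y ∈ S, x ≠ y → x - y ≠ 1}.ncard : ℚ)) =
      (n : ℚ) / ((n - k : ℕ) : ℚ) * ((n - k).choose k : ℚ) := by
  obtain ⟨k, rfl⟩ : ∃ l, k = l + 1 := ⟨k - 1, by omega⟩
  obtain ⟨j, rfl⟩ : ∃ j, n = k + 1 + (j + 1) := ⟨n - k - 2, by omega⟩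
  rw [ncard_zmod _ _ (by omega), card_cycSets _ _ (by omega)]
  have a1 := card_linSets 0 (k + j + 1) (k + 1)
  have a2 : (linSets 1 (k + 1 + (j + 1) - 2) k).card = j.choose k := by
    rcases Nat.eq_zero_or_pos (k + j) with h | h
    · obtain ⟨rfl, rfl⟩ : k = 0 ∧ j = 0 := by omega
      simp [linSets_zero]
    · have := card_linSets 1 (k + j - 1) k
      rw [show 1 + (k + j - 1) = k + 1 + (j + 1) - 2 by omega,
        show k + j - 1 + 1 - k = j by omega] at this
      exact this
  rw [show 0 + (k + j + 1) = k + 1 + (j + 1) - 1 by omega,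
    show k + j + 1 + 1 - (k + 1) = j + 1 by omega] at a1
  rw [a1, a2, show k + 1 + (j + 1) - (k + 1) = j + 1 by omega]
  have a3 : ((j : ℚ) + 1) * (j.choose k : ℚ) = ((j + 1).choose (k + 1) : ℚ) * ((k : ℚ) + 1) := by
    exact_mod_cast Nat.add_one_mul_choose_eq j k
  push_cast
  have : (j : ℚ) + 1 ≠ 0 := by positivity
  field_simp
  linear_combination a3
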